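/- Suppose p₀ ∈ (0,1) and q₀ > 0 are such that ∂T₊/∂q₀(p₀,q₀) = 0. Then q₀ satisfies the identity q₀² − (2p₀² − 1)p₀² = 3p₀³ q₀ ∫_{p₀}^{p₊} √(E + A(u))/u⁴ du > 0, where E = q₀² − A(p₀); in particular q₀² > (2p₀² − 1)p₀², and if p₀ > √(2/3) then q₀ > √A(p₀). -/

import Mathlib

open Real MeasureTheory Set Filter Topology

/-- The potential `A(u) = u²(1 − u²)`. -/
noncomputable def A (u : ℝ) : ℝ := u ^ 2 * (1 - u ^ 2)

/-- `p⋆ = 1/√2`, the unique positive critical point of `A`, with `A p⋆ = 1/4`. -/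
noncomputable def pstar : ℝ := 1 / Real.sqrt 2

/-- For energy `E > −1/4`, the unique root `p₊ > p⋆` of `A(p₊) = −E` (explicit formula). -/
noncomputable def pPlus (E : ℝ) : ℝ := Real.sqrt ((1 + Real.sqrt (1 + 4 * E)) / 2)

/-- For energy `E ∈ (−1/4, 0)`, the unique root `p₋ ∈ (0, p⋆)` of `A(p₋) = −E` (explicit formula). -/
noncomputable def pMinus (E : ℝ) : ℝ := Real.sqrt ((1 - Real.sqrt (1 + 4 * E)) / 2)

/-- The period function `T₊(p₀,q₀) = ∫_{p₀}^{p₊} du/√(E + A(u))`, `E = q₀² − A(p₀)`. -/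
noncomputable def Tplus (p₀ q₀ : ℝ) : ℝ :=
  ∫ u in p₀..pPlus (q₀ ^ 2 - A p₀), 1 / Real.sqrt ((q₀ ^ 2 - A p₀) + A u)

/-- The period function `T₋(p₀,q₀) = ∫_{p₋}^{p₀} du/√(E + A(u))`, `E = q₀² − A(p₀)`. -/
noncomputable def Tminus (p₀ q₀ : ℝ) : ℝ :=
  ∫ u in pMinus (q₀ ^ 2 - A p₀)..p₀, 1 / Real.sqrt ((q₀ ^ 2 - A p₀) + A u)

/-- The radius of the point `(c, 2q)` in polar coordinates. -/
noncomputable def amp (c q : ℝ) : ℝ := √(c ^ 2 + 4 * q ^ 2)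

/-- The angle of the point `(c, 2q)`, `q > 0`, in polar coordinates. -/
noncomputable def phase (c q : ℝ) : ℝ := π / 2 - arctan (c / (2 * q))

/-- The substitution `u = rad c q t`, `t ∈ [0, 1]`, desingularising the period integral. -/
noncomputable def rad (c q t : ℝ) : ℝ := √((1 + amp c q * cos (phase c q * t)) / 2)

/-- The integrand of the period function after the substitution `u = rad c q t`. -/
noncomputable def periodIntegrand (c q t : ℝ) : ℝ := phase c q / (2 * rad c q t)

/-- The `q`-derivative of `periodIntegrand`. -/
noncomputable def periodIntegrandDeriv (c q t : ℝ) : ℝ :=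
  2 * c / amp c q ^ 2 / (2 * rad c q t) -
    phase c q * (4 * q / amp c q * cos (phase c q * t)
      - amp c q * sin (phase c q * t) * (2 * c / amp c q ^ 2 * t)) / (8 * rad c q t ^ 3)

/-- The integrand of `∫ √(E + A(u)) / u⁴ du` after the substitution `u = rad c q t`. -/
noncomputable def weightIntegrand (c q t : ℝ) : ℝ :=
  amp c q ^ 2 / 8 * (phase c q * sin (phase c q * t) ^ 2 / rad c q t ^ 5)

section Polar

variable {c q t : ℝ}

lemma amp_sq (c q : ℝ) : amp c q ^ 2 = c ^ 2 + 4 * q ^ 2 := sq_sqrt (by positivity)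

lemma amp_pos (hq : 0 < q) : 0 < amp c q := sqrt_pos.2 (by positivity)

lemma amp_eq_mul_sqrt (hq : 0 < q) : amp c q = 2 * q * √(1 + (c / (2 * q)) ^ 2) := by
  rw [amp, sqrt_eq_iff_mul_self_eq (by positivity) (by positivity), ← sq, mul_pow,
    sq_sqrt (by positivity)]
  field_simp
  ring

lemma amp_mul_cos_phase (hq : 0 < q) : amp c q * cos (phase c q) = c := by
  rw [phase, cos_pi_div_two_sub, sin_arctan, amp_eq_mul_sqrt hq]
  have : 0 < √(1 + (c / (2 * q)) ^ 2) := sqrt_pos.2 (by positivity)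
  field_simp

lemma amp_mul_sin_phase (hq : 0 < q) : amp c q * sin (phase c q) = 2 * q := by
  rw [phase, sin_pi_div_two_sub, cos_arctan, amp_eq_mul_sqrt hq]
  have : 0 < √(1 + (c / (2 * q)) ^ 2) := sqrt_pos.2 (by positivity)
  field_simp

lemma phase_pos (c q : ℝ) : 0 < phase c q := by
  have := arctan_lt_pi_div_two (c / (2 * q))
  unfold phase; linarith

lemma phase_lt_pi (c q : ℝ) : phase c q < π := by
  have := neg_pi_div_two_lt_arctan (c / (2 * q))
  unfold phase; linarith

lemma phase_mul_mem_Icc (ht : t ∈ Icc (0 : ℝ) 1) : phase c q * t ∈ Icc 0 (phase c q) :=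
  ⟨mul_nonneg (phase_pos c q).le ht.1, mul_le_of_le_one_right (phase_pos c q).le ht.2⟩

lemma sin_phase_mul_pos (ht : t ∈ Ioo (0 : ℝ) 1) : 0 < sin (phase c q * t) :=
  sin_pos_of_pos_of_lt_pi (mul_pos (phase_pos c q) ht.1)
    ((phase_mul_mem_Icc (Ioo_subset_Icc_self ht)).2.trans_lt (phase_lt_pi c q))

lemma one_add_amp_mul_cos_pos (hc : -1 < c) (hq : 0 < q) (ht : t ∈ Icc (0 : ℝ) 1) :
    0 < 1 + amp c q * cos (phase c q * t) := by
  obtain ⟨h0, h1⟩ := phase_mul_mem_Icc (c := c) (q := q) ht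
  have hcos := cos_le_cos_of_nonneg_of_le_pi h0 (phase_lt_pi c q).le h1
  have := mul_le_mul_of_nonneg_left hcos (amp_pos (c := c) hq).le
  rw [amp_mul_cos_phase hq] at this
  linarith

lemma rad_pos (hc : -1 < c) (hq : 0 < q) (ht : t ∈ Icc (0 : ℝ) 1) : 0 < rad c q t :=
  sqrt_pos.2 (half_pos (one_add_amp_mul_cos_pos hc hq ht))

lemma rad_sq (hc : -1 < c) (hq : 0 < q) (ht : t ∈ Icc (0 : ℝ) 1) :
    rad c q t ^ 2 = (1 + amp c q * cos (phase c q * t)) / 2 :=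
  sq_sqrt (half_pos (one_add_amp_mul_cos_pos hc hq ht)).le

lemma hasDerivAt_amp (hq : 0 < q) : HasDerivAt (amp c) (4 * q / amp c q) q := by
  have h : HasDerivAt (fun x : ℝ => c ^ 2 + 4 * x ^ 2) (4 * (2 * q)) q := by
    simpa using ((hasDerivAt_pow 2 q).const_mul 4).const_add (c ^ 2)
  refine (h.sqrt (by positivity)).congr_deriv ?_
  rw [← amp]
  have := amp_pos (c := c) hq
  field_simp

lemma hasDerivAt_phase (hq : 0 < q) : HasDerivAt (phase c) (2 * c / amp c q ^ 2) q := by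
  have h : HasDerivAt (fun x : ℝ => c / (2 * x)) (-(c * 2) / (2 * q) ^ 2) q := by
    simpa using! (hasDerivAt_const q c).div ((hasDerivAt_id q).const_mul 2)
      (by simpa using hq.ne')
  refine (h.arctan.const_sub (π / 2)).congr_deriv ?_
  rw [amp_sq]
  have : 0 < c ^ 2 + 4 * q ^ 2 := by positivity
  field_simp
  ring

lemma hasDerivAt_rad_left (hc : -1 < c) (hq : 0 < q) (ht : t ∈ Icc (0 : ℝ) 1) :
    HasDerivAt (fun x => rad c x t)
      ((4 * q / amp c q * cos (phase c q * t)
        - amp c q * sin (phase c q * t) * (2 * c / amp c q ^ 2 * t)) / (4 * rad c q t)) q := by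
  have h := ((((hasDerivAt_amp (c := c) hq).mul
    ((hasDerivAt_phase hq).mul_const t).cos).const_add 1).div_const 2).sqrt
      (half_pos (one_add_amp_mul_cos_pos hc hq ht)).ne'
  refine h.congr_deriv ?_
  have := rad_pos hc hq ht
  simp only [Pi.mul_apply]
  rw [← rad]
  field_simp
  ring

lemma hasDerivAt_rad_right (hc : -1 < c) (hq : 0 < q) (ht : t ∈ Icc (0 : ℝ) 1) :
    HasDerivAt (rad c q) (-(amp c q * phase c q * sin (phase c q * t)) / (4 * rad c q t)) t := by
  have h := ((((((hasDerivAt_id t).const_mul (phase c q)).cos).const_mul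
    (amp c q)).const_add 1).div_const 2).sqrt (half_pos (one_add_amp_mul_cos_pos hc hq ht)).ne'
  refine h.congr_deriv ?_
  have := rad_pos hc hq ht
  simp only [id]
  rw [← rad]
  field_simp
  ring

lemma continuousOn_rad (hc : -1 < c) (hq : 0 < q) : ContinuousOn (rad c q) (Icc 0 1) :=
  fun _ ht => (hasDerivAt_rad_right hc hq ht).continuousAt.continuousWithinAt

lemma hasDerivAt_periodIntegrand (hc : -1 < c) (hq : 0 < q) (ht : t ∈ Icc (0 : ℝ) 1) :
    HasDerivAt (fun x => periodIntegrand c x t) (periodIntegrandDeriv c q t) q := by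
  have hr := rad_pos hc hq ht
  refine ((hasDerivAt_phase hq).div ((hasDerivAt_rad_left hc hq ht).const_mul 2)
    (by positivity)).congr_deriv ?_
  have := amp_pos (c := c) hq
  unfold periodIntegrandDeriv
  field_simp
  ring

lemma continuousOn_periodIntegrandDeriv (hc : -1 < c) :
    ContinuousOn (Function.uncurry (periodIntegrandDeriv c)) (Ioi 0 ×ˢ Icc 0 1) := by
  have hamp : ContinuousOn (fun x : ℝ × ℝ => amp c x.1) (Ioi 0 ×ˢ Icc 0 1) := by
    unfold amp; fun_prop
  have hphase : ContinuousOn (fun x : ℝ × ℝ => phase c x.1) (Ioi 0 ×ˢ Icc 0 1) := fun x hx =>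
    ((hasDerivAt_phase hx.1).continuousAt.comp continuousAt_fst).continuousWithinAt
  have hrad : ContinuousOn (fun x : ℝ × ℝ => rad c x.1 x.2) (Ioi 0 ×ˢ Icc 0 1) := by
    unfold rad; fun_prop
  have ha : ∀ x ∈ (Ioi 0 ×ˢ Icc 0 1 : Set (ℝ × ℝ)), amp c x.1 ≠ 0 := fun x hx =>
    (amp_pos hx.1).ne'
  have hr : ∀ x ∈ (Ioi 0 ×ˢ Icc 0 1 : Set (ℝ × ℝ)), rad c x.1 x.2 ≠ 0 := fun x hx =>
    (rad_pos hc hx.1 hx.2).ne'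
  unfold Function.uncurry periodIntegrandDeriv
  refine ContinuousOn.sub (ContinuousOn.div (ContinuousOn.div (by fun_prop) (by fun_prop) ?_)
    (by fun_prop) ?_) (ContinuousOn.div (ContinuousOn.mul hphase (ContinuousOn.sub
    (ContinuousOn.mul (ContinuousOn.div (by fun_prop) hamp ha) (by fun_prop))
    (ContinuousOn.mul (by fun_prop) (ContinuousOn.mul (ContinuousOn.div (by fun_prop)
    (by fun_prop) ?_) (by fun_prop))))) (by fun_prop) ?_) <;> intro x hx
  all_goals have := ha x hx; have := hr x hx; positivity

lemma continuousOn_periodIntegrand (hc : -1 < c) (hq : 0 < q) :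
    ContinuousOn (periodIntegrand c q) (Icc 0 1) :=
  continuousOn_const.div (continuousOn_const.mul (continuousOn_rad hc hq)) fun _ ht =>
    (mul_pos two_pos (rad_pos hc hq ht)).ne'

lemma continuousOn_weightIntegrand (hc : -1 < c) (hq : 0 < q) :
    ContinuousOn (weightIntegrand c q) (Icc 0 1) :=
  continuousOn_const.mul (ContinuousOn.div (by fun_prop) ((continuousOn_rad hc hq).pow 5)
    fun _ ht => (pow_pos (rad_pos hc hq ht) 5).ne')

/-- Differentiation under the integral sign. -/
lemma hasDerivAt_integral_periodIntegrand (hc : -1 < c) (hq : 0 < q) :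
    IntervalIntegrable (periodIntegrandDeriv c q) volume 0 1 ∧
    HasDerivAt (fun x => ∫ t in (0 : ℝ)..1, periodIntegrand c x t)
      (∫ t in (0 : ℝ)..1, periodIntegrandDeriv c q t) q := by
  have hsub : Icc (q / 2) (2 * q) ⊆ Ioi 0 := fun x hx => (half_pos hq).trans_le hx.1
  have hcont := continuousOn_periodIntegrandDeriv hc
  obtain ⟨C, hC⟩ := (isCompact_Icc.prod isCompact_Icc).exists_bound_of_continuousOn
    (hcont.mono (prod_mono_left hsub))
  have hIoc : uIoc (0 : ℝ) 1 ⊆ Icc 0 1 := by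
    rw [uIoc_of_le zero_le_one]; exact Ioc_subset_Icc_self
  refine intervalIntegral.hasDerivAt_integral_of_dominated_loc_of_deriv_le
    (s := Icc (q / 2) (2 * q)) (bound := fun _ => C)
    (Icc_mem_nhds (by linarith) (by linarith)) ?_ ?_ ?_ ?_ ?_ ?_
  · filter_upwards [Ioi_mem_nhds hq] with x hx
    exact ((continuousOn_periodIntegrand hc hx).mono hIoc).aestronglyMeasurable
      measurableSet_uIoc
  · exact ContinuousOn.intervalIntegrable_of_Icc zero_le_one (continuousOn_periodIntegrand hc hq)
  · refine ContinuousOn.aestronglyMeasurable ?_ measurableSet_uIoc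
    exact hcont.comp (f := fun t => (q, t)) (by fun_prop) fun t ht => ⟨hq, hIoc ht⟩
  · exact Eventually.of_forall fun t ht x hx => hC (x, t) ⟨hx, hIoc ht⟩
  · exact intervalIntegrable_const
  · exact Eventually.of_forall fun t ht x hx => hasDerivAt_periodIntegrand hc (hsub hx) (hIoc ht)

/-- Up to a total derivative, `periodIntegrandDeriv` is a multiple of `weightIntegrand`. -/
lemma hasDerivAt_boundaryTerm (hc : -1 < c) (hq : 0 < q) (ht : t ∈ Icc (0 : ℝ) 1) :
    HasDerivAt (fun t => 2 * c / amp c q ^ 2 * t / (2 * rad c q t)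
        - 4 * q / amp c q * sin (phase c q * t) / (8 * rad c q t ^ 3))
      (periodIntegrandDeriv c q t - 3 * q / amp c q ^ 2 * weightIntegrand c q t) t := by
  have hr := rad_pos hc hq ht
  have ha := amp_pos (c := c) hq
  have hd := hasDerivAt_rad_right hc hq ht
  have h := (((hasDerivAt_id t).const_mul (2 * c / amp c q ^ 2)).div (hd.const_mul 2)
    (by positivity)).sub (((((hasDerivAt_id t).const_mul (phase c q)).sin).const_mul
      (4 * q / amp c q)).div ((hd.pow 3).const_mul 8) (by simp; positivity))
  refine h.congr_deriv ?_
  simp only [id, Pi.pow_apply]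
  unfold periodIntegrandDeriv weightIntegrand
  field_simp
  ring

lemma rad_zero (c q : ℝ) : rad c q 0 = √((1 + amp c q) / 2) := by simp [rad]

lemma rad_one (hq : 0 < q) : rad c q 1 = √((1 + c) / 2) := by
  rw [rad, mul_one, amp_mul_cos_phase hq]

lemma integral_periodIntegrandDeriv (hc : -1 < c) (hq : 0 < q) :
    ∫ t in (0 : ℝ)..1, periodIntegrandDeriv c q t =
      (c / rad c q 1 - q ^ 2 / rad c q 1 ^ 3 +
        3 * q * ∫ t in (0 : ℝ)..1, weightIntegrand c q t) / amp c q ^ 2 := by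
  have hP := (hasDerivAt_integral_periodIntegrand hc hq).1
  have hW := (continuousOn_weightIntegrand hc hq).intervalIntegrable_of_Icc (μ := volume)
    zero_le_one
  have hftc := intervalIntegral.integral_eq_sub_of_hasDerivAt
    (fun t ht => hasDerivAt_boundaryTerm hc hq (by rwa [uIcc_of_le zero_le_one] at ht))
    (hP.sub (hW.const_mul (3 * q / amp c q ^ 2)))
  rw [intervalIntegral.integral_sub hP (hW.const_mul _), intervalIntegral.integral_const_mul]
    at hftc
  have hr := rad_pos hc hq (right_mem_Icc.2 zero_le_one)
  have ha := amp_pos (c := c) hq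
  have hs : sin (phase c q) = 2 * q / amp c q := by
    rw [eq_div_iff ha.ne', mul_comm, amp_mul_sin_phase hq]
  rw [sub_eq_iff_eq_add.1 hftc]
  simp only [mul_one, mul_zero, sin_zero, hs]
  field_simp
  ring

lemma integral_weightIntegrand_pos (hc : -1 < c) (hq : 0 < q) :
    0 < ∫ t in (0 : ℝ)..1, weightIntegrand c q t := by
  refine intervalIntegral.intervalIntegral_pos_of_pos_on
    ((continuousOn_weightIntegrand hc hq).intervalIntegrable_of_Icc zero_le_one)
    (fun t ht => ?_) one_pos
  have := sin_phase_mul_pos (c := c) (q := q) ht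
  have := rad_pos hc hq (Ioo_subset_Icc_self ht)
  have := amp_pos (c := c) hq
  have := phase_pos c q
  unfold weightIntegrand
  positivity

lemma integral_rad_eq (hc : -1 < c) (hq : 0 < q) (g : ℝ → ℝ) :
    ∫ u in rad c q 1..rad c q 0, g u =
      ∫ t in (0 : ℝ)..1,
        g (rad c q t) * (amp c q * phase c q * sin (phase c q * t) / (4 * rad c q t)) := by
  have h := intervalIntegral.integral_comp_mul_deriv_of_deriv_nonpos (a := 0) (b := 1) (g := g)
    (f := rad c q)
    (f' := fun t => -(amp c q * phase c q * sin (phase c q * t)) / (4 * rad c q t))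
    (by rw [uIcc_of_le zero_le_one]; exact continuousOn_rad hc hq)
    (fun t ht => hasDerivAt_rad_right hc hq (Ioo_subset_Icc_self (by simpa using ht)))
    (fun t ht => by
      have ht' : t ∈ Ioo (0 : ℝ) 1 := by simpa using ht
      have := sin_phase_mul_pos (c := c) (q := q) ht'
      have := rad_pos hc hq (Ioo_subset_Icc_self ht')
      have := amp_pos (c := c) hq
      have := phase_pos c q
      rw [neg_div]
      exact neg_nonpos.2 (by positivity))
  rw [intervalIntegral.integral_symm, ← h, ← intervalIntegral.integral_neg]
  refine intervalIntegral.integral_congr fun t _ => ?_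
  simp only [Function.comp_apply]
  ring

end Polar

section Period

variable {p q t : ℝ}

lemma one_add_four_mul_energy (p q : ℝ) :
    1 + 4 * (q ^ 2 - A p) = (2 * p ^ 2 - 1) ^ 2 + 4 * q ^ 2 := by
  unfold A; ring

lemma pPlus_energy (p q : ℝ) : pPlus (q ^ 2 - A p) = rad (2 * p ^ 2 - 1) q 0 := by
  rw [pPlus, one_add_four_mul_energy, rad_zero, amp]

lemma neg_one_lt_of_pos (hp : 0 < p) : -1 < 2 * p ^ 2 - 1 := by
  have := pow_pos hp 2
  linarith

lemma rad_one_of_pos (hp : 0 < p) (hq : 0 < q) : rad (2 * p ^ 2 - 1) q 1 = p := by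
  rw [rad_one hq, show (1 + (2 * p ^ 2 - 1)) / 2 = p ^ 2 by ring, sqrt_sq hp.le]

lemma sqrt_energy_add_A (hp : 0 < p) (hq : 0 < q) (ht : t ∈ Ioo (0 : ℝ) 1) :
    √(q ^ 2 - A p + A (rad (2 * p ^ 2 - 1) q t)) =
      amp (2 * p ^ 2 - 1) q * sin (phase (2 * p ^ 2 - 1) q * t) / 2 := by
  have hs := sin_phase_mul_pos (c := 2 * p ^ 2 - 1) (q := q) ht
  have ha := amp_pos (c := 2 * p ^ 2 - 1) hq
  rw [← sqrt_sq (show 0 ≤ amp (2 * p ^ 2 - 1) q * sin (phase (2 * p ^ 2 - 1) q * t) / 2 by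
    positivity)]
  congr 1
  have hE := one_add_four_mul_energy p q
  rw [← amp_sq] at hE
  rw [A.eq_def (rad _ _ _), rad_sq (neg_one_lt_of_pos hp) hq (Ioo_subset_Icc_self ht), div_pow,
    mul_pow, sin_sq]
  linear_combination hE / 4

lemma Tplus_eq_integral (hp : 0 < p) (hq : 0 < q) :
    Tplus p q = ∫ t in (0 : ℝ)..1, periodIntegrand (2 * p ^ 2 - 1) q t := by
  have hc := neg_one_lt_of_pos hp
  have h := integral_rad_eq hc hq fun u => 1 / √(q ^ 2 - A p + A u)
  rw [rad_one_of_pos hp hq, ← pPlus_energy] at h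
  rw [Tplus, h]
  refine intervalIntegral.integral_congr_Ioo_of_le zero_le_one fun t ht => ?_
  have hs := sin_phase_mul_pos (c := 2 * p ^ 2 - 1) (q := q) ht
  have ha := amp_pos (c := 2 * p ^ 2 - 1) hq
  have hr := rad_pos hc hq (Ioo_subset_Icc_self ht)
  simp only [sqrt_energy_add_A hp hq ht, periodIntegrand]
  field_simp
  ring

lemma integral_sqrt_energy_eq (hp : 0 < p) (hq : 0 < q) :
    ∫ u in p..pPlus (q ^ 2 - A p), √(q ^ 2 - A p + A u) / u ^ 4 =
      ∫ t in (0 : ℝ)..1, weightIntegrand (2 * p ^ 2 - 1) q t := by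
  have hc := neg_one_lt_of_pos hp
  have h := integral_rad_eq hc hq fun u => √(q ^ 2 - A p + A u) / u ^ 4
  rw [rad_one_of_pos hp hq, ← pPlus_energy] at h
  rw [h]
  refine intervalIntegral.integral_congr_Ioo_of_le zero_le_one fun t ht => ?_
  have hr := rad_pos hc hq (Ioo_subset_Icc_self ht)
  simp only [sqrt_energy_add_A hp hq ht, weightIntegrand]
  field_simp
  ring

lemma hasDerivAt_Tplus (hp : 0 < p) (hq : 0 < q) :
    HasDerivAt (Tplus p)
      (((2 * p ^ 2 - 1) / p - q ^ 2 / p ^ 3 +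
        3 * q * ∫ u in p..pPlus (q ^ 2 - A p), √(q ^ 2 - A p + A u) / u ^ 4) /
          amp (2 * p ^ 2 - 1) q ^ 2) q := by
  have hc := neg_one_lt_of_pos hp
  have h := (hasDerivAt_integral_periodIntegrand hc hq).2
  rw [integral_periodIntegrandDeriv hc hq, rad_one_of_pos hp hq,
    ← integral_sqrt_energy_eq hp hq] at h
  refine h.congr_of_eventuallyEq ?_
  filter_upwards [Ioi_mem_nhds hq] with x hx using Tplus_eq_integral hp hx

end Period

/-- if `p₀ ∈ (0,1)`, `q₀ > 0` and `∂T₊/∂q₀(p₀,q₀) = 0`, then with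
`E = q₀² − A(p₀)` one has `q₀² − (2p₀²−1)p₀² = 3p₀³q₀ ∫_{p₀}^{p₊} √(E+A(u))/u⁴ du > 0`;
in particular `q₀² > (2p₀²−1)p₀²`, and if `p₀ > √(2/3)` then `q₀ > √A(p₀)`. -/
theorem critical_point_identity (p₀ q₀ : ℝ) (hp₀ : p₀ ∈ Set.Ioo (0 : ℝ) 1) (hq₀ : 0 < q₀)
    (hcrit : deriv (fun q => Tplus p₀ q) q₀ = 0) :
    q₀ ^ 2 - (2 * p₀ ^ 2 - 1) * p₀ ^ 2 =
      3 * p₀ ^ 3 * q₀ *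
        ∫ u in p₀..pPlus (q₀ ^ 2 - A p₀), Real.sqrt ((q₀ ^ 2 - A p₀) + A u) / u ^ 4 ∧
    0 < q₀ ^ 2 - (2 * p₀ ^ 2 - 1) * p₀ ^ 2 ∧
    (2 * p₀ ^ 2 - 1) * p₀ ^ 2 < q₀ ^ 2 ∧
    (Real.sqrt (2 / 3) < p₀ → Real.sqrt (A p₀) < q₀) := by
  obtain ⟨hp, hp1⟩ := hp₀
  have hd : deriv (fun q => Tplus p₀ q) q₀ = _ := (hasDerivAt_Tplus hp hq₀).deriv
  have hJ : 0 < ∫ u in p₀..pPlus (q₀ ^ 2 - A p₀), √((q₀ ^ 2 - A p₀) + A u) / u ^ 4 := by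
    rw [integral_sqrt_energy_eq hp hq₀]
    exact integral_weightIntegrand_pos (neg_one_lt_of_pos hp) hq₀
  rw [hcrit, eq_comm, div_eq_zero_iff,
    or_iff_left (pow_ne_zero 2 (amp_pos (c := 2 * p₀ ^ 2 - 1) hq₀).ne')] at hd
  set J := ∫ u in p₀..pPlus (q₀ ^ 2 - A p₀), √((q₀ ^ 2 - A p₀) + A u) / u ^ 4
  have hid : q₀ ^ 2 - (2 * p₀ ^ 2 - 1) * p₀ ^ 2 = 3 * p₀ ^ 3 * q₀ * J := by
    field_simp at hd
    linear_combination -hd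
  have hpos : 0 < q₀ ^ 2 - (2 * p₀ ^ 2 - 1) * p₀ ^ 2 := hid ▸ by positivity
  refine ⟨hid, hpos, sub_pos.1 hpos, fun h => ?_⟩
  have h23 : 2 / 3 < p₀ ^ 2 := (sqrt_lt' hp).1 h
  rw [sqrt_lt' hq₀, A]
  nlinarith
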